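/- Let Λ = A_{n,m} be the self-injective Nakayama algebra with n simple modules and Loewy length m, X the indecomposable module corresponding to the vertex (0,t) in ℤA_{m−1}/⟨τ^n⟩ with 0 < t ≤ m/2, and i ≥ 0. Then Ext^{2i}_Λ(X,X) ≠ 0 if and only if the remainder of im modulo n is strictly less than t, and Ext^{2i+1}_Λ(X,X) ≠ 0 if and only if the remainder of im modulo n is at least n − t. (For 2i the condition is interpreted with i > 0.) -/

import Mathlib

open CategoryTheory CategoryTheory.Limits Opposite

universe u

namespace Rigidity

variable (Λ : Type u) [Ring Λ]

/-- `X` belongs to `add M`: it is a direct summand of a finite direct sum of copies of `M`. -/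
def InAdd (M X : ModuleCat.{u} Λ) : Prop :=
  ∃ (r : ℕ) (Y : ModuleCat.{u} Λ), Nonempty ((X ⊞ Y) ≅ ⨁ (fun _ : Fin r => M))

/-- An indecomposable object. -/
def Indec (X : ModuleCat.{u} Λ) : Prop :=
  ¬ IsZero X ∧ ∀ A B : ModuleCat.{u} Λ, Nonempty (X ≅ A ⊞ B) → IsZero A ∨ IsZero B

/-- A generator-cogenerator: `add M` contains the regular module and all
finitely generated injective modules. -/
def IsGenCogen (M : ModuleCat.{u} Λ) : Prop :=
  InAdd Λ M (ModuleCat.of Λ Λ) ∧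
  ∀ I : ModuleCat.{u} Λ, Module.Finite Λ I → Injective I → InAdd Λ M I

/-- `g : A ⟶ X` is a right minimal `add M`-approximation. -/
def IsRMApprox (M : ModuleCat.{u} Λ) {A X : ModuleCat.{u} Λ} (g : A ⟶ X) : Prop :=
  InAdd Λ M A ∧
  (∀ T : ModuleCat.{u} Λ, InAdd Λ M T → ∀ f : T ⟶ X, ∃ h : T ⟶ A, h ≫ g = f) ∧
  (∀ h : A ⟶ A, h ≫ g = g → IsIso h)

/-- `IsMSyzygy M X r W` : `W` is an `r`-th `M`-syzygy `Ω_M^r(X)` of `X`. -/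
inductive IsMSyzygy (M : ModuleCat.{u} Λ) : ModuleCat.{u} Λ → ℕ → ModuleCat.{u} Λ → Prop
  | zero (X : ModuleCat.{u} Λ) : IsMSyzygy M X 0 X
  | succ (X : ModuleCat.{u} Λ) (r : ℕ) (W A : ModuleCat.{u} Λ) (g : A ⟶ W)
      (hW : IsMSyzygy M X r W) (hg : IsRMApprox Λ M g) :
      IsMSyzygy M X (r + 1) (kernel g)

/-- The `M`-dimension of `X` is at most `r`. -/
def MdimLE (M X : ModuleCat.{u} Λ) (r : ℕ) : Prop :=
  ∃ W : ModuleCat.{u} Λ, IsMSyzygy Λ M X r W ∧ InAdd Λ M W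

/-- projective dimension at most `r`, via a length `r` projective resolution. -/
def ProjDimLE (A : Type u) [Ring A] (N : ModuleCat.{u} A) (r : ℕ) : Prop :=
  ∃ (P : ℕ → ModuleCat.{u} A) (d : ∀ i : ℕ, P (i + 1) ⟶ P i) (f : P 0 ⟶ N),
    (∀ i, Projective (P i)) ∧ (∀ i, r < i → IsZero (P i)) ∧ Epi f ∧
    (∃ w : d 0 ≫ f = 0, (ShortComplex.mk (d 0) f w).Exact) ∧
    (∀ i, ∃ w : d (i + 1) ≫ d i = 0, (ShortComplex.mk (d (i + 1)) (d i) w).Exact)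

/-- global dimension at most `r`. -/
def GldimLE (A : Type u) [Ring A] (r : ℕ) : Prop :=
  ∀ N : ModuleCat.{u} A, ProjDimLE A N r

/-- the global dimension, as an element of `ℕ∞`. -/
noncomputable def gldim (A : Type u) [Ring A] : ℕ∞ :=
  sInf {c : ℕ∞ | ∃ r : ℕ, c = (r : ℕ∞) ∧ GldimLE A r}

/-- dominant dimension at least `r`: there is an exact sequence
`0 → A → I^0 → ⋯ → I^(r-1)` with all `I^i` projective-injective. -/
def DomdimGE (A : Type u) [Ring A] (r : ℕ) : Prop :=
  ∃ (I : ℕ → ModuleCat.{u} A) (f : ModuleCat.of A A ⟶ I 0) (g : ∀ i : ℕ, I i ⟶ I (i + 1)),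
    Mono f ∧ (∀ i, i < r → Injective (I i) ∧ Projective (I i)) ∧
    (2 ≤ r → ∃ w : f ≫ g 0 = 0, (ShortComplex.mk f (g 0) w).Exact) ∧
    (∀ i, i + 3 ≤ r → ∃ w : g i ≫ g (i + 1) = 0, (ShortComplex.mk (g i) (g (i + 1)) w).Exact)

/-- the dominant dimension, as an element of `ℕ∞`. -/
noncomputable def domdim (A : Type u) [Ring A] : ℕ∞ :=
  sSup {c : ℕ∞ | ∃ r : ℕ, c = (r : ℕ∞) ∧ DomdimGE A r}

/-- the rigidity degree of a module, as an element of `ℕ∞`. -/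
noncomputable def rigDeg [HasExt.{u} (ModuleCat.{u} Λ)] (M : ModuleCat.{u} Λ) : ℕ∞ :=
  sSup {c : ℕ∞ | ∃ r : ℕ, c = (r : ℕ∞) ∧ 0 < r ∧
    ∀ i : ℕ, 1 ≤ i → i ≤ r → Subsingleton (Abelian.Ext M M i)}

/-- the rigidity dimension. -/
noncomputable def rigdim : ℕ∞ :=
  sSup {c : ℕ∞ | ∃ M : ModuleCat.{u} Λ, Module.Finite Λ M ∧ IsGenCogen Λ M ∧
    (∃ r : ℕ, GldimLE (End (op M)) r) ∧ c = domdim (End (op M))}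

/-- An Auslander-Reiten (almost split) sequence. -/
def IsARSeq {X Y Z : ModuleCat.{u} Λ} (f : X ⟶ Y) (g : Y ⟶ Z) : Prop :=
  Mono f ∧ Epi g ∧ (∃ w : f ≫ g = 0, (ShortComplex.mk f g w).Exact) ∧
  Indec Λ X ∧ Indec Λ Z ∧
  (¬ ∃ s : Z ⟶ Y, s ≫ g = 𝟙 Z) ∧
  (∀ (W : ModuleCat.{u} Λ) (h : W ⟶ Z), (¬ ∃ s : Z ⟶ W, s ≫ h = 𝟙 Z) →
    ∃ h' : W ⟶ Y, h' ≫ g = h)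

/-- `X` has composition length `t`. -/
def HasCompLength (X : ModuleCat.{u} Λ) (t : ℕ) : Prop :=
  (∃ c : Fin (t + 1) → Submodule Λ X, StrictMono c ∧ c 0 = ⊥ ∧ c (Fin.last t) = ⊤) ∧
  ∀ r : ℕ, (∃ c : Fin (r + 1) → Submodule Λ X, StrictMono c ∧ c 0 = ⊥ ∧ c (Fin.last r) = ⊤) →
    r ≤ t


/-- powers of the Jacobson radical, as left submodules of `Λ`. -/
def radPow (Λ : Type u) [Ring Λ] : ℕ → Submodule Λ Λ
  | 0 => ⊤
  | r + 1 => Submodule.span Λ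
      {x : Λ | ∃ a ∈ Ideal.jacobson (⊥ : Ideal Λ), ∃ b ∈ radPow Λ r, x = a * b}

/-- `Λ` is the connected self-injective Nakayama algebra over `k`
with `n` simple modules and Loewy length `m`. -/
structure IsSelfInjNakayama (k : Type u) (Λ : Type u) [Field k] [Ring Λ] [Algebra k Λ]
    (n m : ℕ) : Prop where
  findim : FiniteDimensional k Λ
  connected : ∀ e : Λ, IsIdempotentElem e → e ∈ Set.center Λ → e = 0 ∨ e = 1
  selfinj : Injective (ModuleCat.of Λ Λ)
  uniserial : ∀ X : ModuleCat.{u} Λ, Module.Finite Λ X → Indec Λ X →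
    ∀ N₁ N₂ : Submodule Λ X, N₁ ≤ N₂ ∨ N₂ ≤ N₁
  simples : ∃ S : Fin n → ModuleCat.{u} Λ, (∀ i, IsSimpleModule Λ (S i)) ∧
    (∀ i j, Nonempty (S i ≅ S j) → i = j) ∧
    ∀ T : ModuleCat.{u} Λ, IsSimpleModule Λ T → ∃ i, Nonempty (T ≅ S i)
  loewy_top : radPow Λ m = ⊥
  loewy_bot : radPow Λ (m - 1) ≠ ⊥

section Uniserial

variable {Λ : Type u} [Ring Λ]

/-- A module whose submodules form a chain. -/
def Uniserial (Λ : Type u) [Ring Λ] (M : Type u) [AddCommGroup M] [Module Λ M] : Prop :=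
  ∀ N₁ N₂ : Submodule Λ M, N₁ ≤ N₂ ∨ N₂ ≤ N₁

/-- The composition length as a natural number (zero for modules of infinite length). -/
noncomputable def len (Λ : Type u) [Ring Λ] (M : Type u) [AddCommGroup M] [Module Λ M] : ℕ :=
  (Module.length Λ M).toNat

variable {M N : Type u} [AddCommGroup M] [Module Λ M] [AddCommGroup N] [Module Λ N]

theorem Uniserial.submodule (h : Uniserial Λ M) (K : Submodule Λ M) : Uniserial Λ K := fun A B => by
  rcases h (A.map K.subtype) (B.map K.subtype) with h | h
  · exact Or.inl ((Submodule.map_le_map_iff_of_injective K.subtype_injective _ _).1 h)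
  · exact Or.inr ((Submodule.map_le_map_iff_of_injective K.subtype_injective _ _).1 h)

theorem Uniserial.of_surjective (h : Uniserial Λ M) (f : M →ₗ[Λ] N) (hf : Function.Surjective f) :
    Uniserial Λ N := fun A B => by
  rcases h (A.comap f) (B.comap f) with h | h
  · exact Or.inl ((Submodule.comap_le_comap_iff_of_surjective hf).1 h)
  · exact Or.inr ((Submodule.comap_le_comap_iff_of_surjective hf).1 h)

theorem len_congr (e : M ≃ₗ[Λ] N) : len Λ M = len Λ N := by
  rw [len, len, e.length_eq]

theorem len_eq_one [IsSimpleModule Λ M] : len Λ M = 1 := by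
  rw [len, Module.length_eq_one]; rfl

theorem len_bot : len Λ (⊥ : Submodule Λ M) = 0 := by
  simp [len]

theorem len_top : len Λ (⊤ : Submodule Λ M) = len Λ M := by
  simp [len]

variable [IsArtinianRing Λ]

theorem len_add [Module.Finite Λ M] (K : Submodule Λ M) :
    len Λ K + len Λ (M ⧸ K) = len Λ M := by
  rw [len, len, len, ← ENat.toNat_add Module.length_ne_top Module.length_ne_top,
    ← Module.length_eq_add_of_exact K.subtype K.mkQ K.subtype_injective K.mkQ_surjective
      (LinearMap.exact_subtype_mkQ K)]

theorem len_le_of_injective [Module.Finite Λ N] (f : M →ₗ[Λ] N) (hf : Function.Injective f) :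
    len Λ M ≤ len Λ N :=
  ENat.toNat_le_toNat (Module.length_le_of_injective f hf) Module.length_ne_top

theorem len_le_of_surjective [Module.Finite Λ M] (f : M →ₗ[Λ] N) (hf : Function.Surjective f) :
    len Λ N ≤ len Λ M :=
  ENat.toNat_le_toNat (Module.length_le_of_surjective f hf) Module.length_ne_top

theorem len_ker_add_range [Module.Finite Λ M] (f : M →ₗ[Λ] N) :
    len Λ (LinearMap.ker f) + len Λ (LinearMap.range f) = len Λ M := by
  rw [← len_add (LinearMap.ker f), len_congr f.quotKerEquivRange]

theorem len_ker_add [Module.Finite Λ M] (f : M →ₗ[Λ] N) (hf : Function.Surjective f) :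
    len Λ (LinearMap.ker f) + len Λ N = len Λ M := by
  rw [← len_add (LinearMap.ker f), len_congr (f.quotKerEquivOfSurjective hf)]

theorem eq_top_of_len [Module.Finite Λ M] {A : Submodule Λ M} (h : len Λ M ≤ len Λ A) : A = ⊤ := by
  by_contra hA
  have := Submodule.length_lt hA
  rw [← ENat.natCast_toNat (Module.length_ne_top (R := Λ) (M := A)),
    ← ENat.natCast_toNat (Module.length_ne_top (R := Λ) (M := M)), Nat.cast_lt] at this
  exact absurd h (not_le.2 this)

theorem eq_of_le_of_len [Module.Finite Λ M] {A B : Submodule Λ M} (h : A ≤ B)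
    (hl : len Λ B ≤ len Λ A) : A = B := by
  refine le_antisymm h ?_
  have : A.submoduleOf B = ⊤ := eq_top_of_len (by
    rwa [len_congr (Submodule.submoduleOfEquivOfLe h)])
  exact Submodule.submoduleOf_eq_top.1 this

theorem len_lt [Module.Finite Λ M] {A B : Submodule Λ M} (h : A < B) : len Λ A < len Λ B := by
  by_contra hl
  exact h.ne (eq_of_le_of_len h.le (not_lt.1 hl))

theorem surjective_of_len [Module.Finite Λ M] [Module.Finite Λ N] (f : M →ₗ[Λ] N)
    (hf : Function.Injective f) (h : len Λ N ≤ len Λ M) : Function.Surjective f := by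
  rw [← LinearMap.range_eq_top]
  exact eq_top_of_len (by rwa [← len_congr (LinearEquiv.ofInjective f hf)])

theorem Uniserial.le_of_len [Module.Finite Λ M] (h : Uniserial Λ M) {A B : Submodule Λ M}
    (hl : len Λ A ≤ len Λ B) : A ≤ B := by
  rcases h A B with h | h
  · exact h
  · exact (eq_of_le_of_len h hl).ge

theorem Uniserial.eq_of_len [Module.Finite Λ M] (h : Uniserial Λ M) {A B : Submodule Λ M}
    (hl : len Λ A = len Λ B) : A = B :=
  le_antisymm (h.le_of_len hl.le) (h.le_of_len hl.ge)

theorem len_pos [Module.Finite Λ M] [Nontrivial M] : 0 < len Λ M := by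
  have h : (⊥ : Submodule Λ M) < ⊤ := bot_lt_top
  have := len_lt h
  rw [len_top] at this
  omega

theorem eq_bot_of_len [Module.Finite Λ M] {A : Submodule Λ M} (h : len Λ A = 0) : A = ⊥ :=
  (eq_of_le_of_len bot_le (by simp [h])).symm

end Uniserial

section Layers

variable {Λ : Type u} [Ring Λ] {n : ℕ} {S : Fin n → ModuleCat.{u} Λ}
variable {M N : Type u} [AddCommGroup M] [Module Λ M] [AddCommGroup N] [Module Λ N]

/-- The simple module `S i` is a quotient of `M`. -/
def HasTop (S : Fin n → ModuleCat.{u} Λ) (M : Type u) [AddCommGroup M] [Module Λ M]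
    (i : Fin n) : Prop :=
  ∃ f : M →ₗ[Λ] S i, Function.Surjective f

/-- The simple module `S i` is a quotient of a submodule of `M` of colength `j`. If `M` is
uniserial, this says that `S i` is the `j`-th radical layer of `M`. -/
def Layer (S : Fin n → ModuleCat.{u} Λ) (M : Type u) [AddCommGroup M] [Module Λ M]
    (j : ℕ) (i : Fin n) : Prop :=
  ∃ K : Submodule Λ M, len Λ K + j = len Λ M ∧ HasTop S K i

/-- `S` is a complete irredundant list of simple modules, and the left ideals `P i` are uniserial,
projective and injective with top `S i`. -/
structure IsCovers (S : Fin n → ModuleCat.{u} Λ) (P : Fin n → Submodule Λ Λ) : Prop where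
  simple : ∀ i, IsSimpleModule Λ (S i)
  irredundant : ∀ i j, Nonempty (S i ≃ₗ[Λ] S j) → i = j
  complete : ∀ (T : Type u) [AddCommGroup T] [Module Λ T], IsSimpleModule Λ T →
    ∃ i, Nonempty (T ≃ₗ[Λ] S i)
  projective : ∀ i, Module.Projective Λ (P i)
  injective : ∀ i, Module.Injective Λ (P i)
  uniserial : ∀ i, Uniserial Λ (P i)
  top : ∀ i, HasTop S (P i) i

theorem HasTop.of_surjective {i : Fin n} (h : HasTop S N i) (f : M →ₗ[Λ] N)
    (hf : Function.Surjective f) : HasTop S M i := by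
  obtain ⟨g, hg⟩ := h
  exact ⟨g ∘ₗ f, hg.comp hf⟩

namespace IsCovers

variable {P : Fin n → Submodule Λ Λ} (hP : IsCovers S P)
include hP

theorem nontrivial_of_hasTop {i : Fin n} (h : HasTop S M i) : Nontrivial M := by
  obtain ⟨f, hf⟩ := h
  have := hP.simple i
  have := IsSimpleModule.nontrivial Λ (S i)
  exact hf.nontrivial

theorem top_unique (hM : Uniserial Λ M) {i j : Fin n} (hi : HasTop S M i) (hj : HasTop S M j) :
    i = j := by
  obtain ⟨f, hf⟩ := hi
  obtain ⟨g, hg⟩ := hj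
  have := hP.simple i
  have := hP.simple j
  have cf := LinearMap.isCoatom_ker_of_surjective hf
  have cg := LinearMap.isCoatom_ker_of_surjective hg
  have e : LinearMap.ker f = LinearMap.ker g := by
    rcases hM (LinearMap.ker f) (LinearMap.ker g) with h | h
    · exact h.antisymm ((cf.le_iff.1 h).resolve_left cg.1).le
    · exact ((cg.le_iff.1 h).resolve_left cf.1).le.antisymm h
  exact hP.irredundant i j ⟨(f.quotKerEquivOfSurjective hf).symm.trans
    ((Submodule.quotEquivOfEq _ _ e).trans (g.quotKerEquivOfSurjective hg))⟩

theorem exists_surjective (hM : Uniserial Λ M) {i : Fin n} (hi : HasTop S M i) :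
    ∃ g : P i →ₗ[Λ] M, Function.Surjective g := by
  obtain ⟨f, hf⟩ := hi
  obtain ⟨p, hp⟩ := hP.top i
  have := hP.projective i
  have := hP.simple i
  have := IsSimpleModule.nontrivial Λ (S i)
  obtain ⟨g, hg⟩ := Module.projective_lifting_property f p hf
  refine ⟨g, LinearMap.range_eq_top.1 ?_⟩
  rcases hM (LinearMap.range g) (LinearMap.ker f) with h | h
  · rw [LinearMap.range_le_ker_iff, hg] at h
    obtain ⟨y, hy⟩ := exists_ne (0 : S i)
    obtain ⟨x, rfl⟩ := hp y
    simp [h] at hy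
  · refine eq_top_iff.2 fun x _ => ?_
    obtain ⟨y, hy⟩ := hp (f x)
    have hk : x - g y ∈ LinearMap.ker f := by
      rw [← hg] at hy
      simpa [sub_eq_zero] using hy.symm
    simpa using add_mem (h hk) (LinearMap.mem_range_self g y)

theorem exists_hasTop [IsArtinianRing Λ] [Module.Finite Λ M] [Nontrivial M] :
    ∃ i, HasTop S M i := by
  obtain ⟨K, hK, -⟩ := (eq_top_or_exists_le_coatom (⊥ : Submodule Λ M)).resolve_left bot_ne_top
  obtain ⟨i, ⟨e⟩⟩ := hP.complete (M ⧸ K) (isSimpleModule_iff_isCoatom.2 hK)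
  exact ⟨i, e.toLinearMap ∘ₗ K.mkQ, e.surjective.comp K.mkQ_surjective⟩

theorem hasTop_of_surjective [IsArtinianRing Λ] [Module.Finite Λ N] [Nontrivial N]
    (hM : Uniserial Λ M) {i : Fin n} (hi : HasTop S M i) (f : M →ₗ[Λ] N)
    (hf : Function.Surjective f) : HasTop S N i := by
  obtain ⟨j, hj⟩ := hP.exists_hasTop (M := N)
  rwa [hP.top_unique hM hi (hj.of_surjective f hf)]

variable [IsArtinianRing Λ]

theorem lt_of_layer [Module.Finite Λ M] {i : Fin n} {j : ℕ} (h : Layer S M j i) :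
    j < len Λ M := by
  obtain ⟨K, hK, hi⟩ := h
  have := hP.nontrivial_of_hasTop hi
  have := len_pos (Λ := Λ) (M := K)
  omega

theorem exists_colength [Module.Finite Λ M] {j : ℕ} (hj : j ≤ len Λ M) :
    ∃ K : Submodule Λ M, len Λ K + j = len Λ M := by
  induction j with
  | zero => exact ⟨⊤, by rw [len_top, add_zero]⟩
  | succ j ih =>
    obtain ⟨K, hK⟩ := ih (by omega)
    have : Nontrivial K := by
      rw [Submodule.nontrivial_iff_ne_bot]
      rintro rfl
      rw [len_bot] at hK
      omega
    obtain ⟨i, f, hf⟩ := hP.exists_hasTop (M := K)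
    have := hP.simple i
    have h := len_ker_add f hf
    rw [len_eq_one (M := S i)] at h
    refine ⟨(LinearMap.ker f).map K.subtype, ?_⟩
    rw [← len_congr (Submodule.equivMapOfInjective K.subtype K.subtype_injective _)]
    omega

theorem exists_layer [Module.Finite Λ M] {j : ℕ} (hj : j < len Λ M) : ∃ i, Layer S M j i := by
  obtain ⟨K, hK⟩ := hP.exists_colength hj.le
  have : Nontrivial K := by
    rw [Submodule.nontrivial_iff_ne_bot]
    rintro rfl
    rw [len_bot] at hK
    omega
  obtain ⟨i, hi⟩ := hP.exists_hasTop (M := K)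
  exact ⟨i, K, hK, hi⟩

theorem layer_unique [Module.Finite Λ M] (hM : Uniserial Λ M) {j : ℕ} {i i' : Fin n}
    (h : Layer S M j i) (h' : Layer S M j i') : i = i' := by
  obtain ⟨K, hK, hi⟩ := h
  obtain ⟨K', hK', hi'⟩ := h'
  obtain rfl : K = K' := hM.eq_of_len (by omega)
  exact hP.top_unique (hM.submodule K) hi hi'

omit hP in
theorem layer_of_surjective [Module.Finite Λ M] {j : ℕ} {i : Fin n} (f : M →ₗ[Λ] N)
    (hf : Function.Surjective f) (h : Layer S N j i) : Layer S M j i := by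
  obtain ⟨K, hK, hi⟩ := h
  have := Module.Finite.of_surjective f hf
  have h₁ := len_add K
  have h₂ := len_ker_add (K.mkQ ∘ₗ f) (K.mkQ_surjective.comp hf)
  have hmem : ∀ x, x ∈ LinearMap.ker (K.mkQ ∘ₗ f) ↔ f x ∈ K := fun x => by simp
  refine ⟨LinearMap.ker (K.mkQ ∘ₗ f), by omega, hi.of_surjective
    ((f ∘ₗ Submodule.subtype _).codRestrict K fun x => (hmem _).1 x.2) fun y => ?_⟩
  obtain ⟨x, hx⟩ := hf y
  exact ⟨⟨x, (hmem x).2 (hx ▸ y.2)⟩, Subtype.ext hx⟩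

omit hP [IsArtinianRing Λ] in
theorem layer_of_submodule {K : Submodule Λ M} {c j : ℕ} {i : Fin n}
    (hc : len Λ K + c = len Λ M) (h : Layer S K j i) : Layer S M (c + j) i := by
  obtain ⟨L, hL, hi⟩ := h
  have e := Submodule.equivMapOfInjective K.subtype K.subtype_injective L
  refine ⟨L.map K.subtype, ?_, hi.of_surjective e.symm.toLinearMap e.symm.surjective⟩
  rw [← len_congr e]
  omega

omit hP [IsArtinianRing Λ] in
theorem layer_zero {i : Fin n} (h : HasTop S M i) : Layer S M 0 i :=
  ⟨⊤, by rw [len_top, add_zero], h.of_surjective _ Submodule.topEquiv.surjective⟩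

theorem exists_ne_zero_iff [Module.Finite Λ M] [Module.Finite Λ N] (hM : Uniserial Λ M)
    (hN : Uniserial Λ N) {i : Fin n} (hi : HasTop S M i) :
    (∃ f : M →ₗ[Λ] N, f ≠ 0) ↔ ∃ j, Layer S N j i ∧ len Λ N ≤ len Λ M + j := by
  constructor
  · rintro ⟨f, hf⟩
    have : Nontrivial (LinearMap.range f) := by
      rwa [Submodule.nontrivial_iff_ne_bot, Ne, LinearMap.range_eq_bot]
    have h₁ := len_add (LinearMap.range f)
    have h₂ := len_ker_add_range f
    exact ⟨len Λ (N ⧸ LinearMap.range f), ⟨LinearMap.range f, h₁,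
      hP.hasTop_of_surjective hM hi f.rangeRestrict f.surjective_rangeRestrict⟩, by omega⟩
  · rintro ⟨j, ⟨K, hK, hKi⟩, hle⟩
    obtain ⟨g, hg⟩ := hP.exists_surjective hM hi
    obtain ⟨g', hg'⟩ := hP.exists_surjective (hN.submodule K) hKi
    have h₁ := len_ker_add g hg
    have h₂ := len_ker_add g' hg'
    have hker : LinearMap.ker g ≤ LinearMap.ker g' := (hP.uniserial i).le_of_len (by omega)
    let q : M →ₗ[Λ] K :=
      (LinearMap.ker g).liftQ g' hker ∘ₗ (g.quotKerEquivOfSurjective hg).symm.toLinearMap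
    have hq : ∀ x, q (g x) = g' x := fun x => by
      have : (g.quotKerEquivOfSurjective hg).symm (g x) = Submodule.Quotient.mk x := by
        rw [LinearEquiv.symm_apply_eq]; rfl
      simp [q, this]
    have := hP.nontrivial_of_hasTop hKi
    obtain ⟨y, hy⟩ := exists_ne (0 : K)
    obtain ⟨x, rfl⟩ := hg' y
    refine ⟨K.subtype ∘ₗ q, fun h => hy ?_⟩
    have := LinearMap.congr_fun h (g x)
    rw [← hq x]
    exact Subtype.ext this

end IsCovers

end Layers

section Covers

variable {Λ : Type u} [Ring Λ]

theorem exists_indec_summand [IsArtinianRing Λ] {T : Type u} [AddCommGroup T] [Module Λ T]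
    (φ : Λ →ₗ[Λ] T) (hφ : φ ≠ 0) :
    ∃ P : Submodule Λ Λ, (∃ p : Λ →ₗ[Λ] P, ∀ x : P, p x = x) ∧ ¬ P ≤ LinearMap.ker φ ∧
      Indec Λ (ModuleCat.of Λ P) := by
  let C : Set (Submodule Λ Λ) :=
    {P | (∃ p : Λ →ₗ[Λ] P, ∀ x : P, p x = x) ∧ ¬ P ≤ LinearMap.ker φ}
  have hC : C.Nonempty := by
    refine ⟨⊤, ⟨Submodule.topEquiv.symm.toLinearMap, fun x => rfl⟩, fun h => hφ ?_⟩
    exact LinearMap.ker_eq_top.1 (top_le_iff.1 h)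
  obtain ⟨P, ⟨⟨p, hp⟩, hPφ⟩, hmin⟩ := wellFounded_lt.has_min C hC
  refine ⟨P, ⟨p, hp⟩, hPφ, fun hz => hPφ ?_, ?_⟩
  · have := ModuleCat.subsingleton_of_isZero hz
    intro x hx
    have : (⟨x, hx⟩ : P) = 0 := Subsingleton.elim (α := P) _ _
    have : x = 0 := congrArg Subtype.val this
    simp [this]
  · rintro A B ⟨e⟩
    have key : ∀ (A B : ModuleCat.{u} Λ) (ι : A ⟶ ModuleCat.of Λ P) (π : ModuleCat.of Λ P ⟶ A)
        (π' : ModuleCat.of Λ P ⟶ B) (ι' : B ⟶ ModuleCat.of Λ P), ι ≫ π = 𝟙 A → ι ≫ π' = 0 →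
        ι' ≫ π' = 𝟙 B →
        ¬ (LinearMap.range (P.subtype ∘ₗ ι.hom)) ≤ LinearMap.ker φ → IsZero B := by
      intro A B ι π π' ι' h₁ h₂ h₃ hr
      have hle : LinearMap.range (P.subtype ∘ₗ ι.hom) ≤ P := by
        rintro _ ⟨a, rfl⟩
        exact (ι.hom a).2
      have heq : LinearMap.range (P.subtype ∘ₗ ι.hom) = P := by
        by_contra hne
        refine hmin _ ⟨⟨(P.subtype ∘ₗ ι.hom).rangeRestrict ∘ₗ π.hom ∘ₗ p, ?_⟩, hr⟩
          (lt_of_le_of_ne hle hne)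
        rintro ⟨_, a, rfl⟩
        refine Subtype.ext ?_
        have : π.hom (ι.hom a) = a := congrArg (fun f => f.hom a) h₁
        simp [hp, this]
      rw [IsZero.iff_id_eq_zero]
      ext b
      obtain ⟨a, ha⟩ := heq.ge (ι'.hom b).2
      have hab : ι.hom a = ι'.hom b := Subtype.ext ha
      have e₁ : π'.hom (ι'.hom b) = b := congrArg (fun f => f.hom b) h₃
      have e₂ : π'.hom (ι.hom a) = 0 := congrArg (fun f => f.hom a) h₂
      rw [hab, e₁] at e₂
      simp [e₂]
    by_cases hA : LinearMap.range (P.subtype ∘ₗ (biprod.inl ≫ e.inv).hom) ≤ LinearMap.ker φ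
    · by_cases hB : LinearMap.range (P.subtype ∘ₗ (biprod.inr ≫ e.inv).hom) ≤ LinearMap.ker φ
      · refine absurd (fun x hx => ?_) hPφ
        have hid : (⟨x, hx⟩ : P) = (biprod.inl ≫ e.inv).hom ((e.hom ≫ biprod.fst).hom ⟨x, hx⟩) +
            (biprod.inr ≫ e.inv).hom ((e.hom ≫ biprod.snd).hom ⟨x, hx⟩) := by
          have : 𝟙 (ModuleCat.of Λ P) = (e.hom ≫ biprod.fst) ≫ biprod.inl ≫ e.inv +
              (e.hom ≫ biprod.snd) ≫ biprod.inr ≫ e.inv := by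
            have := congrArg (fun q => e.hom ≫ q ≫ e.inv) (biprod.total (X := A) (Y := B))
            simp only [Preadditive.add_comp, Preadditive.comp_add, Category.assoc,
              Category.id_comp, Iso.hom_inv_id] at this
            simpa only [Category.assoc] using this.symm
          exact congrArg (fun f => f.hom (⟨x, hx⟩ : P)) this
        have hx' := congrArg Subtype.val hid
        rw [show x = _ from hx']
        exact add_mem (hA ⟨_, rfl⟩) (hB ⟨_, rfl⟩)
      · exact Or.inl (key B A (biprod.inr ≫ e.inv) (e.hom ≫ biprod.snd) (e.hom ≫ biprod.fst)
          (biprod.inl ≫ e.inv) (by simp) (by simp) (by simp) hB)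
    · exact Or.inr (key A B (biprod.inl ≫ e.inv) (e.hom ≫ biprod.fst) (e.hom ≫ biprod.snd)
          (biprod.inr ≫ e.inv) (by simp) (by simp) (by simp) hA)

theorem injective_of_retract {M N : Type u} [AddCommGroup M] [Module Λ M] [AddCommGroup N]
    [Module Λ N] [hN : Module.Injective Λ N] (i : M →ₗ[Λ] N) (p : N →ₗ[Λ] M)
    (h : ∀ x, p (i x) = x) : Module.Injective Λ M where
  out X Y _ _ _ _ f hf g := by
    obtain ⟨k, hk⟩ := hN.out f hf (i ∘ₗ g)
    exact ⟨p ∘ₗ k, fun x => by simp [hk, h]⟩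

theorem exists_isCovers [IsArtinianRing Λ] [Module.Injective Λ Λ] {n : ℕ}
    (S : Fin n → ModuleCat.{u} Λ)
    (hS : ∀ i, IsSimpleModule Λ (S i)) (hirr : ∀ i j, Nonempty (S i ≅ S j) → i = j)
    (hcomp : ∀ T : ModuleCat.{u} Λ, IsSimpleModule Λ T → ∃ i, Nonempty (T ≅ S i))
    (huni : ∀ X : ModuleCat.{u} Λ, Module.Finite Λ X → Indec Λ X → Uniserial Λ X) :
    ∃ P, IsCovers S P := by
  have key : ∀ i, ∃ P : Submodule Λ Λ, Module.Projective Λ P ∧ Module.Injective Λ P ∧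
      Uniserial Λ P ∧ HasTop S P i := by
    intro i
    have := hS i
    have := IsSimpleModule.nontrivial Λ (S i)
    obtain ⟨y, hy⟩ := exists_ne (0 : S i)
    obtain ⟨P, ⟨p, hp⟩, hPφ, hind⟩ := exists_indec_summand (LinearMap.toSpanSingleton Λ (S i) y)
      (fun h => hy (by simpa using LinearMap.congr_fun h 1))
    refine ⟨P, Module.Projective.of_split P.subtype p (LinearMap.ext hp),
      injective_of_retract P.subtype p hp,
      huni (ModuleCat.of Λ P) (inferInstanceAs (Module.Finite Λ P)) hind,
      LinearMap.toSpanSingleton Λ (S i) y ∘ₗ P.subtype, ?_⟩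
    refine LinearMap.surjective_of_ne_zero fun h => hPφ fun x hx => ?_
    exact LinearMap.congr_fun h ⟨x, hx⟩
  choose P h₁ h₂ h₃ h₄ using key
  refine ⟨P, hS, fun i j ⟨e⟩ => hirr i j ⟨e.toModuleIso⟩, fun T _ _ hT => ?_, h₁, h₂, h₃, h₄⟩
  obtain ⟨i, ⟨e⟩⟩ := hcomp (ModuleCat.of Λ T) hT
  exact ⟨i, ⟨e.toLinearEquiv⟩⟩

end Covers

section Connected

variable {Λ : Type u} [Ring Λ] {n : ℕ} {S : Fin n → ModuleCat.{u} Λ} {P : Fin n → Submodule Λ Λ}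

/-- The trace in `Λ` of the left ideals `P i` with `i ∈ C`. -/
def traceIdeal (P : Fin n → Submodule Λ Λ) (C : Set (Fin n)) : Submodule Λ Λ :=
  Submodule.span Λ {x | ∃ i ∈ C, ∃ (f : P i →ₗ[Λ] Λ) (p : P i), f p = x}

theorem apply_mem_traceIdeal {C : Set (Fin n)} {i : Fin n} (hi : i ∈ C) (f : P i →ₗ[Λ] Λ)
    (p : P i) : f p ∈ traceIdeal P C :=
  Submodule.subset_span ⟨i, hi, f, p, rfl⟩

theorem IsCovers.traceIdeal_sup_compl [IsArtinianRing Λ] (hP : IsCovers S P) (C : Set (Fin n)) :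
    traceIdeal P C ⊔ traceIdeal P Cᶜ = ⊤ := by
  by_contra hne
  obtain ⟨K, hK, hle⟩ := (eq_top_or_exists_le_coatom _).resolve_left hne
  obtain ⟨i, ⟨e⟩⟩ := hP.complete (Λ ⧸ K) (isSimpleModule_iff_isCoatom.2 hK)
  obtain ⟨p, hp⟩ := hP.top i
  have := hP.projective i
  have := hP.simple i
  have := IsSimpleModule.nontrivial Λ (S i)
  obtain ⟨g, hg⟩ := Module.projective_lifting_property (e.toLinearMap ∘ₗ K.mkQ) p
    (e.surjective.comp K.mkQ_surjective)
  obtain ⟨y, hy⟩ := exists_ne (0 : S i)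
  obtain ⟨x, rfl⟩ := hp y
  have hx : g x ∈ K := hle (by
    by_cases hi : i ∈ C
    · exact Submodule.mem_sup_left (apply_mem_traceIdeal hi g x)
    · exact Submodule.mem_sup_right (apply_mem_traceIdeal (C := Cᶜ) hi g x))
  apply hy
  rw [← hg]
  simp [(Submodule.Quotient.mk_eq_zero K).2 hx]

theorem mul_eq_zero_of_mem_traceIdeal {C D : Set (Fin n)}
    (h : ∀ i ∈ C, ∀ j ∈ D, ∀ f : P i →ₗ[Λ] P j, f = 0) {a b : Λ} (ha : a ∈ traceIdeal P C)
    (hb : b ∈ traceIdeal P D) : a * b = 0 := by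
  have key : ∀ j ∈ D, ∀ p : P j, a • p = 0 := by
    intro j hj p
    induction ha using Submodule.span_induction with
    | mem x hx =>
      obtain ⟨i, hi, f, q, rfl⟩ := hx
      exact LinearMap.congr_fun (h i hi j hj (LinearMap.toSpanSingleton Λ (P j) p ∘ₗ f)) q
    | zero => simp
    | add x y _ _ hx hy => rw [add_smul, hx, hy, add_zero]
    | smul r x _ hx => rw [smul_assoc, hx, smul_zero]
  have hle : traceIdeal P D ≤ {
      carrier := {x | ∀ c : Λ, a * (c * x) = 0}
      add_mem' := fun hx hy c => by rw [mul_add, mul_add, hx c, hy c, add_zero]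
      zero_mem' := fun c => by simp
      smul_mem' := fun r x hx c => by
        rw [smul_eq_mul, ← mul_assoc c]
        exact hx (c * r) : Submodule Λ Λ} := by
    refine Submodule.span_le.2 ?_
    rintro _ ⟨j, hj, f, p, rfl⟩ c
    have := congrArg f (key j hj (c • p))
    simpa using this
  simpa using hle hb 1

theorem IsCovers.forall_mem_of_connected [IsArtinianRing Λ] (hP : IsCovers S P)
    (hconn : ∀ e : Λ, IsIdempotentElem e → e ∈ Set.center Λ → e = 0 ∨ e = 1)
    {C : Set (Fin n)} (h₁ : ∀ i ∈ C, ∀ j ∉ C, ∀ f : P i →ₗ[Λ] P j, f = 0)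
    (h₂ : ∀ i ∉ C, ∀ j ∈ C, ∀ f : P i →ₗ[Λ] P j, f = 0) {i : Fin n} (hi : i ∈ C) (j : Fin n) :
    j ∈ C := by
  by_contra hj
  have hone : (1 : Λ) ∈ traceIdeal P C ⊔ traceIdeal P Cᶜ := by
    rw [hP.traceIdeal_sup_compl]; trivial
  obtain ⟨a, ha, b, hb, hab⟩ := Submodule.mem_sup.1 hone
  have hCD : ∀ {x y : Λ}, x ∈ traceIdeal P C → y ∈ traceIdeal P Cᶜ → x * y = 0 :=
    mul_eq_zero_of_mem_traceIdeal h₁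
  have hDC : ∀ {x y : Λ}, x ∈ traceIdeal P Cᶜ → y ∈ traceIdeal P C → x * y = 0 :=
    mul_eq_zero_of_mem_traceIdeal h₂
  have hne : ∀ k, ∃ x : P k, (P k).subtype x ≠ 0 := fun k => by
    have := hP.nontrivial_of_hasTop (hP.top k)
    obtain ⟨x, hx⟩ := exists_ne (0 : P k)
    exact ⟨x, fun h => hx (Subtype.ext h)⟩
  have hidem : a * a = a := by
    calc a * a = a * (a + b) := by rw [mul_add, hCD ha hb, add_zero]
      _ = a := by rw [hab, mul_one]
  have hcent : a ∈ Set.center Λ := by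
    rw [Semigroup.mem_center_iff]
    intro x
    have e₁ : x * a = a * x * a := by
      calc x * a = (a + b) * (x * a) := by rw [hab, one_mul]
        _ = a * x * a := by
          rw [add_mul, hDC hb (show x * a ∈ traceIdeal P C from Submodule.smul_mem _ x ha),
            add_zero, mul_assoc]
    have e₂ : a * x = a * x * a := by
      calc a * x = a * x * (a + b) := by rw [hab, mul_one]
        _ = a * x * a := by
          rw [mul_add, mul_assoc a x b,
            hCD ha (show x * b ∈ traceIdeal P Cᶜ from Submodule.smul_mem _ x hb), add_zero]
    rw [e₁, ← e₂]
  rcases hconn a hidem hcent with rfl | rfl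
  · obtain ⟨x, hx⟩ := hne i
    rw [zero_add] at hab
    apply hx
    rw [← mul_one (Submodule.subtype _ x), ← hab]
    exact hCD (apply_mem_traceIdeal hi _ x) hb
  · obtain ⟨x, hx⟩ := hne j
    apply hx
    rw [← mul_one (Submodule.subtype _ x)]
    exact hDC (apply_mem_traceIdeal (C := Cᶜ) hj _ x) ha

end Connected

section Radical

variable {Λ : Type u} [Ring Λ]
variable {M N : Type u} [AddCommGroup M] [Module Λ M] [AddCommGroup N] [Module Λ N]

/-- The radical series of a module over an artinian ring. -/
def radSeries (Λ : Type u) [Ring Λ] (M : Type u) [AddCommGroup M] [Module Λ M] :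
    ℕ → Submodule Λ M
  | 0 => ⊤
  | r + 1 => Ring.jacobson Λ • radSeries Λ M r

theorem radPow_eq_radSeries (r : ℕ) : radPow Λ r = radSeries Λ Λ r := by
  induction r with
  | zero => rfl
  | succ r ih =>
    rw [radPow, radSeries, ih, Ideal.jacobson_bot]
    apply le_antisymm
    · refine Submodule.span_le.2 ?_
      rintro _ ⟨a, ha, b, hb, rfl⟩
      exact Submodule.smul_mem_smul ha hb
    · exact Submodule.smul_le.2 fun a ha b hb => Submodule.subset_span ⟨a, ha, b, hb, rfl⟩

theorem map_mem_radSeries (f : M →ₗ[Λ] N) {r : ℕ} {x : M} (hx : x ∈ radSeries Λ M r) :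
    f x ∈ radSeries Λ N r := by
  induction r generalizing x with
  | zero => trivial
  | succ r ih =>
    rw [radSeries] at hx
    induction hx using Submodule.smul_induction_on' with
    | smul a ha y hy =>
      rw [map_smul]
      exact Submodule.smul_mem_smul ha (ih hy)
    | add x _ y _ hx hy =>
      rw [map_add]
      exact add_mem hx hy

variable [IsArtinianRing Λ]

theorem Uniserial.len_jacobson_smul_top [Module.Finite Λ M] [Nontrivial M] (hM : Uniserial Λ M) :
    len Λ (Ring.jacobson Λ • (⊤ : Submodule Λ M) : Submodule Λ M) + 1 = len Λ M := by
  set K : Submodule Λ M := Ring.jacobson Λ • ⊤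
  have htor : Module.IsTorsionBySet Λ (M ⧸ K) (Ring.jacobson Λ) :=
    (Module.isTorsionBySet_quotient_iff _ _).2 fun m i hi => Submodule.smul_mem_smul hi trivial
  have hss : IsSemisimpleModule Λ (M ⧸ K) := by
    let _ := htor.module
    exact (htor.semilinearMap.isSemisimpleModule_iff_of_bijective Function.bijective_id).2
      inferInstance
  have hlt : K < ⊤ := Submodule.jacobson_smul_lt_top ⊤
  have : Nontrivial (M ⧸ K) := Submodule.Quotient.nontrivial_iff.2 hlt.ne
  have hu : Uniserial Λ (M ⧸ K) := hM.of_surjective K.mkQ K.mkQ_surjective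
  have : IsSimpleModule Λ (M ⧸ K) := by
    refine (isSimpleModule_iff _ _).2 { eq_bot_or_eq_top := fun A => ?_ }
    obtain ⟨B, hB⟩ := exists_isCompl A
    rcases hu A B with h | h
    · exact Or.inl (by simpa [inf_eq_left.2 h] using hB.inf_eq_bot)
    · exact Or.inr (by simpa [sup_eq_left.2 h] using hB.sup_eq_top)
  rw [← len_add K, len_eq_one (M := M ⧸ K)]

theorem Uniserial.len_radSeries [Module.Finite Λ M] (hM : Uniserial Λ M) (r : ℕ) :
    len Λ (radSeries Λ M r) = len Λ M - r := by
  induction r with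
  | zero => exact len_top
  | succ r ih =>
    set K := radSeries Λ M r with hK
    have hmap : (Ring.jacobson Λ • (⊤ : Submodule Λ K)).map K.subtype = radSeries Λ M (r + 1) := by
      rw [Submodule.map_smul'', Submodule.map_top, Submodule.range_subtype]
      rfl
    rw [← hmap, ← len_congr (Submodule.equivMapOfInjective K.subtype K.subtype_injective _)]
    rcases subsingleton_or_nontrivial K with h | h
    · have h₀ : len Λ K = 0 := by
        rw [(Submodule.subsingleton_iff_eq_bot).1 h, len_bot]
      have := len_le_of_injective (Submodule.subtype (Ring.jacobson Λ • (⊤ : Submodule Λ K)))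
        (Submodule.subtype_injective _)
      omega
    · have := (hM.submodule K).len_jacobson_smul_top
      omega

variable {n : ℕ} {S : Fin n → ModuleCat.{u} Λ} {P : Fin n → Submodule Λ Λ}

theorem IsCovers.len_le_of_radPow_eq_bot (hP : IsCovers S P) {r : ℕ} (h : radPow Λ r = ⊥)
    (a : Fin n) : len Λ (P a) ≤ r := by
  have h₀ : radSeries Λ (P a) r = ⊥ := by
    refine eq_bot_iff.2 fun x hx => ?_
    have := map_mem_radSeries (P a).subtype hx
    rw [← radPow_eq_radSeries, h] at this
    exact Subtype.ext this
  have := (hP.uniserial a).len_radSeries r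
  rw [h₀, len_bot] at this
  omega

theorem IsCovers.exists_lt_len (hP : IsCovers S P) {r : ℕ} (h : radPow Λ r ≠ ⊥) :
    ∃ a, r < len Λ (P a) := by
  by_contra! hle
  have hbot : ∀ a, radSeries Λ (P a) r = ⊥ := fun a => eq_bot_of_len (by
    have := hle a
    rw [(hP.uniserial a).len_radSeries]
    omega)
  refine h (eq_bot_iff.2 fun x hx => ?_)
  rw [radPow_eq_radSeries] at hx
  have hkill : ∀ a (p : P a), x • p = 0 := fun a p => by
    have := map_mem_radSeries (LinearMap.toSpanSingleton Λ (P a) p) hx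
    rwa [hbot] at this
  have hone : (1 : Λ) ∈ traceIdeal P Set.univ := by
    have := hP.traceIdeal_sup_compl Set.univ
    rw [Set.compl_univ] at this
    have hle : traceIdeal P ∅ ≤ traceIdeal P Set.univ :=
      Submodule.span_mono fun y ⟨i, hi, _⟩ => hi.elim
    rw [sup_eq_left.2 hle] at this
    rw [this]; trivial
  have hle : traceIdeal P Set.univ ≤ {
      carrier := {y | ∀ c : Λ, x * (c * y) = 0}
      add_mem' := fun hx hy c => by rw [mul_add, mul_add, hx c, hy c, add_zero]
      zero_mem' := fun c => by simp
      smul_mem' := fun r y hy c => by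
        rw [smul_eq_mul, ← mul_assoc c]
        exact hy (c * r) : Submodule Λ Λ} := by
    refine Submodule.span_le.2 ?_
    rintro _ ⟨j, hj, f, p, rfl⟩ c
    have := congrArg f (hkill j (c • p))
    simpa using this
  simpa using hle hone 1

end Radical

section Permutation

variable {Λ : Type u} [Ring Λ] [IsArtinianRing Λ] {n : ℕ} {S : Fin n → ModuleCat.{u} Λ}
  {P : Fin n → Submodule Λ Λ}

namespace IsCovers

variable (hP : IsCovers S P)
include hP

omit [IsArtinianRing Λ] in
theorem eq_of_injective {a b : Fin n} (f : P a →ₗ[Λ] P b) (hf : Function.Injective f) :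
    a = b := by
  have := hP.injective a
  obtain ⟨r, hr⟩ := Module.Injective.out f hf LinearMap.id
  exact hP.top_unique (hP.uniserial b) ((hP.top a).of_surjective r fun x => ⟨f x, hr x⟩) (hP.top b)

theorem surjective_of_injective {a b : Fin n} (f : P a →ₗ[Λ] P b) (hf : Function.Injective f) :
    Function.Surjective f := by
  obtain rfl := hP.eq_of_injective f hf
  exact surjective_of_len f hf le_rfl

theorem exists_layer_ne_zero {a b : Fin n} {f : P a →ₗ[Λ] P b} (hf : f ≠ 0) :
    ∃ j, Layer S (P b) j a := by
  obtain ⟨j, hj, -⟩ := (hP.exists_ne_zero_iff (hP.uniserial a) (hP.uniserial b) (hP.top a)).1 ⟨f, hf⟩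
  exact ⟨j, hj⟩

theorem eq_of_len_eq_one {a b : Fin n} (ha : len Λ (P a) = 1) {f : P a →ₗ[Λ] P b} (hf : f ≠ 0) :
    a = b := by
  refine hP.eq_of_injective f (LinearMap.ker_eq_bot.1 (eq_bot_of_len ?_))
  have : Nontrivial (LinearMap.range f) := by
    rwa [Submodule.nontrivial_iff_ne_bot, Ne, LinearMap.range_eq_bot]
  have h₁ := len_ker_add_range f
  have h₂ := len_pos (Λ := Λ) (M := LinearMap.range f)
  omega

theorem eq_of_len_eq_one' {a b : Fin n} (ha : len Λ (P a) = 1) {f : P b →ₗ[Λ] P a} (hf : f ≠ 0) :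
    b = a := by
  obtain ⟨j, hj⟩ := hP.exists_layer_ne_zero hf
  have := hP.lt_of_layer hj
  obtain rfl : j = 0 := by omega
  exact hP.layer_unique (hP.uniserial a) hj (layer_zero (hP.top a))

theorem two_le_len (hconn : ∀ e : Λ, IsIdempotentElem e → e ∈ Set.center Λ → e = 0 ∨ e = 1)
    (hlong : ∃ b, 2 ≤ len Λ (P b)) (a : Fin n) : 2 ≤ len Λ (P a) := by
  by_contra hlt
  have := hP.nontrivial_of_hasTop (hP.top a)
  have hpos := len_pos (Λ := Λ) (M := P a)
  have ha : len Λ (P a) = 1 := by omega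
  obtain ⟨b, hb⟩ := hlong
  have hmem : b ∈ ({a} : Set (Fin n)) := by
    refine hP.forall_mem_of_connected hconn ?_ ?_ (Set.mem_singleton a) b
    · rintro i rfl j hj f
      by_contra hf
      exact hj (hP.eq_of_len_eq_one ha hf).symm
    · rintro i hi j rfl f
      by_contra hf
      exact hi (hP.eq_of_len_eq_one' ha hf)
  rw [Set.mem_singleton_iff] at hmem
  subst hmem
  omega

theorem layer_iterate {σ : Fin n → Fin n} (hσ : ∀ a, Layer S (P a) 1 (σ a)) (a : Fin n) {j : ℕ}
    (hj : j < len Λ (P a)) : Layer S (P a) j (σ^[j] a) := by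
  induction j with
  | zero => exact layer_zero (hP.top a)
  | succ j ih =>
    obtain ⟨K, hK, hi⟩ := ih (by omega)
    obtain ⟨c, hc⟩ := hP.exists_layer (M := K) (j := 1) (by omega)
    obtain ⟨g, hg⟩ := hP.exists_surjective ((hP.uniserial a).submodule K) hi
    have e := hP.layer_unique (hP.uniserial _) (layer_of_surjective g hg hc) (hσ _)
    rw [Function.iterate_succ_apply', ← e]
    exact layer_of_submodule hK hc

theorem eq_of_socle {a b c : Fin n} {i j : ℕ} (hi : i + 1 = len Λ (P a))
    (hj : j + 1 = len Λ (P b)) (ha : Layer S (P a) i c) (hb : Layer S (P b) j c) : a = b := by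
  have key : ∀ {a : Fin n} {i : ℕ}, i + 1 = len Λ (P a) → Layer S (P a) i c →
      ∃ K : Submodule Λ (P a), Nonempty (K ≃ₗ[Λ] S c) := by
    rintro a i hi ⟨K, hK, f, hf⟩
    have := hP.simple c
    have h := len_ker_add f hf
    rw [len_eq_one (M := S c)] at h
    exact ⟨K, ⟨LinearEquiv.ofBijective f ⟨LinearMap.ker_eq_bot.1 (eq_bot_of_len (by omega)), hf⟩⟩⟩
  obtain ⟨K, ⟨e⟩⟩ := key hi ha
  obtain ⟨K', ⟨e'⟩⟩ := key hj hb
  have := hP.injective b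
  obtain ⟨h, hh⟩ := Module.Injective.out K.subtype K.subtype_injective
    (K'.subtype ∘ₗ (e.trans e'.symm).toLinearMap)
  have hinj : ∀ x : K, h x = 0 → x = 0 := fun x hx => by
    have := (hh x).symm.trans hx
    simpa using this
  refine hP.eq_of_injective h (LinearMap.ker_eq_bot.1 (eq_bot_iff.2 ?_))
  rcases hP.uniserial a (LinearMap.ker h) K with hle | hle
  · intro x hx
    exact congrArg Subtype.val (hinj ⟨x, hle hx⟩ hx)
  · have := hP.simple c
    have := IsSimpleModule.nontrivial Λ (S c)
    obtain ⟨y, hy⟩ := exists_ne (0 : S c)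
    exact absurd (hinj (e.symm y) (hle (e.symm y).2)) (by simpa using hy)

theorem len_le_len_of_layer {a b : Fin n} (h : Layer S (P a) 1 b) :
    len Λ (P a) ≤ len Λ (P b) := by
  obtain ⟨K, hK, hi⟩ := h
  obtain ⟨g, hg⟩ := hP.exists_surjective ((hP.uniserial a).submodule K) hi
  have hlen := len_ker_add g hg
  by_contra hlt
  have hinj : Function.Injective g := LinearMap.ker_eq_bot.1 (eq_bot_of_len (by omega))
  have hsurj := hP.surjective_of_injective (K.subtype ∘ₗ g) (K.subtype_injective.comp hinj)
  have := len_le_of_surjective K.subtype (Function.Surjective.of_comp hsurj)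
  omega

theorem exists_perm (hconn : ∀ e : Λ, IsIdempotentElem e → e ∈ Set.center Λ → e = 0 ∨ e = 1)
    {m : ℕ} (hm : 2 ≤ m) (htop : radPow Λ m = ⊥) (hbot : radPow Λ (m - 1) ≠ ⊥) :
    (∀ a, len Λ (P a) = m) ∧ ∃ σ : Equiv.Perm (Fin n),
      (∀ a j, j < m → Layer S (P a) j ((σ ^ j) a)) ∧
      ∀ a x y, (σ ^ x) a = (σ ^ y) a ↔ x ≡ y [MOD n] := by
  have hle := hP.len_le_of_radPow_eq_bot htop
  obtain ⟨b, hb⟩ := hP.exists_lt_len hbot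
  have htwo := hP.two_le_len hconn ⟨b, by omega⟩
  choose σ hσ using fun a => hP.exists_layer (M := P a) (j := 1) (htwo a)
  have hσj := fun a j (hj : j < len Λ (P a)) => hP.layer_iterate hσ a hj
  have hν : Function.Injective fun a => σ^[len Λ (P a) - 1] a := fun a a' h => by
    have h₁ := htwo a
    have h₂ := htwo a'
    refine hP.eq_of_socle (i := len Λ (P a) - 1) (j := len Λ (P a') - 1) (by omega) (by omega)
      (hσj a _ (by omega)) ?_
    rw [show σ^[len Λ (P a) - 1] a = _ from h]
    exact hσj a' _ (by omega)
  have hsurj : Function.Surjective σ := fun c => by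
    obtain ⟨a, rfl⟩ := Finite.surjective_of_injective hν c
    refine ⟨σ^[len Λ (P a) - 2] a, ?_⟩
    have := htwo a
    rw [← Function.iterate_succ_apply' σ, show (len Λ (P a) - 2).succ = len Λ (P a) - 1 by omega]
  let e : Equiv.Perm (Fin n) := Equiv.ofBijective σ (Finite.injective_iff_bijective.1
    (Finite.injective_iff_surjective.2 hsurj))
  have he : ∀ j a, (e ^ j) a = σ^[j] a := fun j a => by
    rw [← Equiv.Perm.iterate_eq_pow]; rfl
  have hcyc : ∀ a b, e.SameCycle a b := fun a b => by
    have key : ∀ i j, ∀ f : P i →ₗ[Λ] P j, f ≠ 0 → e.SameCycle j i := fun i j f hf => by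
      obtain ⟨x, hx⟩ := hP.exists_layer_ne_zero hf
      have := hP.layer_unique (hP.uniserial j) hx (hσj j x (hP.lt_of_layer hx))
      exact ⟨x, by rw [zpow_natCast, he, this]⟩
    have := hP.forall_mem_of_connected hconn (C := {j | e.SameCycle a j}) ?_ ?_
      (Equiv.Perm.SameCycle.refl e a) b
    · exact this
    · intro i hi j hj f
      by_contra hf
      exact hj (Equiv.Perm.SameCycle.trans hi (key i j f hf).symm)
    · intro i hi j hj f
      by_contra hf
      exact hi (Equiv.Perm.SameCycle.trans hj (key i j f hf))
  have hlen : ∀ a, len Λ (P a) = m := fun a => by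
    obtain ⟨x, rfl⟩ := (hcyc b a).exists_nat_pow_eq
    have hmono : len Λ (P b) ≤ len Λ (P ((e ^ x) b)) := by
      induction x with
      | zero => exact le_rfl
      | succ x ih =>
        refine ih.trans ?_
        rw [he, he, Function.iterate_succ_apply']
        exact hP.len_le_len_of_layer (hσ _)
    have := hle ((e ^ x) b)
    omega
  refine ⟨hlen, e, fun a j hj => ?_, fun a x y => ?_⟩
  · rw [he]
    exact hσj a j (by rwa [hlen])
  · have hon : e.IsCycleOn ((Finset.univ : Finset (Fin n)) : Set (Fin n)) :=
      ⟨by simp, fun x _ y _ => hcyc x y⟩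
    simpa using hon.pow_apply_eq_pow_apply (Finset.mem_univ a) (m := x) (n := y)

end IsCovers

end Permutation

section Ext

theorem subsingleton_ext_succ_iff {C : Type*} [Category C] [Abelian C] [HasExt.{u} C]
    {T : ShortComplex C} (hT : T.ShortExact) [Projective T.X₂] {Y : C} {r : ℕ}
    (h : ∀ y : Abelian.Ext T.X₂ Y r, (Abelian.Ext.mk₀ T.f).comp y (zero_add r) = 0) :
    Subsingleton (Abelian.Ext T.X₃ Y (r + 1)) ↔ Subsingleton (Abelian.Ext T.X₁ Y r) := by
  constructor <;> intro _
  · refine subsingleton_of_forall_eq 0 fun x => ?_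
    obtain ⟨y, rfl⟩ := Abelian.Ext.contravariant_sequence_exact₁ hT Y x (add_comm 1 r)
      (Subsingleton.elim _ _)
    exact h y
  · refine subsingleton_of_forall_eq 0 fun x => ?_
    obtain ⟨y, rfl⟩ := Abelian.Ext.contravariant_sequence_exact₃ hT Y x
      (Abelian.Ext.eq_zero_of_projective _) (add_comm 1 r)
    rw [Subsingleton.elim y 0, Abelian.Ext.comp_zero]

variable {Λ : Type u} [Ring Λ] [IsArtinianRing Λ] {n : ℕ} {S : Fin n → ModuleCat.{u} Λ}
  {P : Fin n → Submodule Λ Λ}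

namespace IsCovers

variable (hP : IsCovers S P)
include hP

theorem len_of_hasCompLength {X : ModuleCat.{u} Λ} [Module.Finite Λ X] (hX : Uniserial Λ X) {t : ℕ}
    (h : HasCompLength Λ X t) : len Λ X = t := by
  refine le_antisymm (h.2 _ ?_) ?_
  · choose K hK using fun i : Fin (len Λ X + 1) =>
      hP.exists_colength (M := X) (j := len Λ X - i) (by omega)
    have hK' : ∀ i, len Λ (K i) = i := fun i => by
      have := hK i
      omega
    refine ⟨K, fun i j hij => lt_of_le_of_ne (hX.le_of_len ?_) fun he => ?_, ?_, ?_⟩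
    · rw [hK', hK']
      exact hij.le
    · have := hK' i
      rw [he, hK'] at this
      exact hij.ne' (Fin.ext this)
    · exact eq_bot_of_len (hK' 0)
    · exact eq_top_of_len (hK' (Fin.last _)).ge
  · obtain ⟨c, hc, -, -⟩ := h.1
    have key : ∀ i : Fin (t + 1), (i : ℕ) ≤ len Λ (c i) := fun i => by
      induction i using Fin.induction with
      | zero => exact Nat.zero_le _
      | succ i ih =>
        have := len_lt (hc (Fin.castSucc_lt_succ (i := i)))
        rw [Fin.val_succ]
        rw [Fin.val_castSucc] at ih
        omega
    have := key (Fin.last t)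
    exact this.trans (len_le_of_injective (c _).subtype (c _).subtype_injective)

variable {m : ℕ} (hlen : ∀ a, len Λ (P a) = m) {σ : Equiv.Perm (Fin n)}
  (hσ : ∀ a j, j < m → Layer S (P a) j ((σ ^ j) a))
include hlen hσ

theorem layer_iff {M : Type u} [AddCommGroup M] [Module Λ M] [Module.Finite Λ M]
    (hM : Uniserial Λ M) {a i : Fin n} (ha : HasTop S M a) {j : ℕ} :
    Layer S M j i ↔ j < len Λ M ∧ i = (σ ^ j) a := by
  obtain ⟨g, hg⟩ := hP.exists_surjective hM ha
  have hle := len_le_of_surjective g hg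
  rw [hlen] at hle
  have key : ∀ {i}, Layer S M j i → i = (σ ^ j) a := fun h =>
    hP.layer_unique (hP.uniserial a) (layer_of_surjective g hg h)
      (hσ a j ((hP.lt_of_layer h).trans_le hle))
  refine ⟨fun h => ⟨hP.lt_of_layer h, key h⟩, ?_⟩
  rintro ⟨hj, rfl⟩
  obtain ⟨i, hi⟩ := hP.exists_layer hj
  rwa [← key hi]

omit hlen in
theorem hasTop_ker {M : Type u} [AddCommGroup M] [Module Λ M] [Module.Finite Λ M]
    {b : Fin n} (hlen : len Λ (P b) = m) (g : P b →ₗ[Λ] M)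
    (hg : Function.Surjective g) (hlt : len Λ M < m) :
    HasTop S (LinearMap.ker g) ((σ ^ len Λ M) b) := by
  obtain ⟨K, hK, hi⟩ := hσ b _ hlt
  have h := len_ker_add g hg
  obtain rfl : K = LinearMap.ker g := (hP.uniserial b).eq_of_len (by omega)
  exact hi

end IsCovers

/-- The total colength of the tops of the iterated syzygies of a uniserial module of length `c`. -/
def syzygyShift (m : ℕ) : ℕ → ℕ → ℕ
  | 0, c => c
  | r + 1, c => syzygyShift m r (m - c) + c

theorem syzygyShift_even {m c : ℕ} (hc : c ≤ m) (q : ℕ) :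
    syzygyShift m (2 * q) c = q * m + c := by
  induction q with
  | zero => simp [syzygyShift]
  | succ q ih =>
    rw [Nat.mul_succ, syzygyShift, syzygyShift, Nat.sub_sub_self hc, ih, Nat.succ_mul]
    omega

theorem syzygyShift_odd {m c : ℕ} (hc : c ≤ m) (q : ℕ) :
    syzygyShift m (2 * q + 1) c = (q + 1) * m := by
  rw [syzygyShift, syzygyShift_even (Nat.sub_le m c), Nat.succ_mul]
  omega

theorem IsCovers.not_subsingleton_ext_iff [HasExt.{u} (ModuleCat.{u} Λ)] (hP : IsCovers S P)
    {m : ℕ} (hlen : ∀ a, len Λ (P a) = m) {σ : Equiv.Perm (Fin n)}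
    (hσ : ∀ a j, j < m → Layer S (P a) j ((σ ^ j) a)) {X : ModuleCat.{u} Λ} [Module.Finite Λ X]
    (hX : Uniserial Λ X) {a : Fin n} (ha : HasTop S X a) (hXm : 2 * len Λ X ≤ m) (r : ℕ)
    {K : ModuleCat.{u} Λ} [Module.Finite Λ K] (hK : Uniserial Λ K) {b : Fin n}
    (hb : HasTop S K b) (hc : len Λ K = len Λ X ∨ len Λ K = m - len Λ X) :
    ¬ Subsingleton (Abelian.Ext K X (r + 1)) ↔
      ∃ j < len Λ X, (σ ^ syzygyShift m r (len Λ K)) b = (σ ^ j) a := by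
  have := hP.nontrivial_of_hasTop ha
  have hpos := len_pos (Λ := Λ) (M := X)
  induction r using Nat.strong_induction_on generalizing K b with
  | _ r ih =>
  obtain ⟨g, hg⟩ := hP.exists_surjective hK hb
  have hker := len_ker_add g hg
  rw [hlen] at hker
  have htop := hP.hasTop_ker hσ (hlen b) g hg (by omega)
  have hu := (hP.uniserial b).submodule (LinearMap.ker g)
  have hT := LinearMap.shortExact_shortComplexKer hg
  have := hP.projective b
  have hproj : Projective g.shortComplexKer.X₂ :=
    (IsProjective.iff_projective (P b)).1 inferInstance
  rcases r with _ | r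
  · have hzero : ∀ f : P b →ₗ[Λ] X, f ∘ₗ (LinearMap.ker g).subtype = 0 := fun f => by
      have hle : LinearMap.ker g ≤ LinearMap.ker f := (hP.uniserial b).le_of_len (by
        have h₁ := len_ker_add_range f
        have h₂ := len_le_of_injective (LinearMap.range f).subtype (Submodule.subtype_injective _)
        rw [hlen] at h₁
        omega)
      exact LinearMap.ext fun x => hle x.2
    have hhom : Subsingleton (Abelian.Ext g.shortComplexKer.X₁ X 0) ↔
        ¬ ∃ f : LinearMap.ker g →ₗ[Λ] X, f ≠ 0 := by
      rw [Abelian.Ext.homEquiv₀.subsingleton_congr, ModuleCat.homEquiv.subsingleton_congr]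
      push Not
      exact subsingleton_iff_forall_eq 0
    rw [subsingleton_ext_succ_iff hT fun y => ?_, hhom, not_not, hP.exists_ne_zero_iff hu hX htop]
    · refine exists_congr fun j => ?_
      rw [hP.layer_iff hlen hσ hX ha, and_assoc]
      exact and_congr_right fun _ => and_iff_left (by omega)
    · obtain ⟨f, rfl⟩ := (Abelian.Ext.mk₀_bijective _ _).2 y
      rw [Abelian.Ext.mk₀_comp_mk₀, show g.shortComplexKer.f ≫ f = 0 from
        ModuleCat.hom_ext (hzero f.hom), Abelian.Ext.mk₀_zero]
  · have hind := ih r (Nat.lt_succ_self r) (K := ModuleCat.of Λ (LinearMap.ker g)) hu htop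
      (by change len Λ (LinearMap.ker g) = _ ∨ len Λ (LinearMap.ker g) = _; omega)
    rw [subsingleton_ext_succ_iff hT fun y => by
      rw [Abelian.Ext.eq_zero_of_projective y, Abelian.Ext.comp_zero]]
    rw [syzygyShift, pow_add, Equiv.Perm.mul_apply,
      show m - len Λ K = len Λ (LinearMap.ker g) by omega]
    exact hind

end Ext

theorem exists_lt_modEq_iff {n t x : ℕ} : (∃ j < t, x ≡ j [MOD n]) ↔ x % n < t := by
  constructor
  · rintro ⟨j, hj, h⟩
    rw [h]
    exact (Nat.mod_le j n).trans_lt hj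
  · exact fun h => ⟨x % n, h, (Nat.mod_modEq x n).symm⟩

theorem exists_lt_add_modEq_iff {n t x : ℕ} (hn : 0 < n) (ht : 0 < t) :
    (∃ j < t, x + t ≡ j [MOD n]) ↔ n - t ≤ x % n := by
  have hx := Nat.mod_lt x hn
  constructor
  · rintro ⟨j, hj, h⟩
    by_contra! hlt
    have h' : (x % n + t) % n = j % n := by rw [Nat.mod_add_mod]; exact h
    rw [Nat.mod_eq_of_lt (show x % n + t < n by omega),
      Nat.mod_eq_of_lt (show j < n by omega)] at h'
    omega
  · intro h
    rw [exists_lt_modEq_iff, ← Nat.mod_add_mod]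
    rcases le_or_gt n t with hnt | hnt
    · exact (Nat.mod_lt _ hn).trans_le hnt
    · rw [Nat.mod_eq_sub_mod (by omega), Nat.mod_eq_of_lt (by omega)]
      omega

/-- Lemma `lem-inSE`(1),(2): for `Λ = A_{n,m}` and `X` the indecomposable
module corresponding to a vertex `(0,t)` with `0 < t ≤ m/2`:
`Ext^{2i}(X,X) ≠ 0` iff `(i*m) % n < t` (for `i > 0`), and
`Ext^{2i+1}(X,X) ≠ 0` iff `(i*m) % n ≥ n - t`. -/
theorem statement5 (k : Type u) [Field k] (Λ : Type u) [Ring Λ] [Algebra k Λ]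
    (n m : ℕ) (hn : 0 < n) (hnm : n ≤ m)
    (hΛ : IsSelfInjNakayama k Λ n m)
    [HasExt.{u} (ModuleCat.{u} Λ)]
    (t : ℕ) (ht : 0 < t) (ht2 : 2 * t ≤ m)
    (X : ModuleCat.{u} Λ) (hXfin : Module.Finite Λ X) (hXind : Indec Λ X)
    (hXlen : HasCompLength Λ X t) :
    (∀ i : ℕ, 0 < i → ((¬ Subsingleton (Abelian.Ext X X (2 * i))) ↔ (i * m) % n < t)) ∧
    (∀ i : ℕ, ((¬ Subsingleton (Abelian.Ext X X (2 * i + 1))) ↔ n - t ≤ (i * m) % n)) := by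
  have := hΛ.findim
  have : IsArtinianRing Λ := IsArtinianRing.of_finite k Λ
  have : Module.Injective Λ Λ :=
    have := hΛ.selfinj
    Module.injective_module_of_injective_object Λ Λ
  obtain ⟨S, hS, hirr, hcomp⟩ := hΛ.simples
  obtain ⟨P, hP⟩ := exists_isCovers S hS hirr hcomp hΛ.uniserial
  obtain ⟨hlen, σ, hσ, hpow⟩ := hP.exists_perm hΛ.connected (by omega) hΛ.loewy_top hΛ.loewy_bot
  have hX : Uniserial Λ X := hΛ.uniserial X hXfin hXind
  obtain rfl := hP.len_of_hasCompLength hX hXlen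
  have : Nontrivial X := by
    by_contra h
    have := not_nontrivial_iff_subsingleton.1 h
    exact hXind.1 (ModuleCat.isZero_of_subsingleton X)
  obtain ⟨a, ha⟩ := hP.exists_hasTop (M := X)
  have key := fun r => hP.not_subsingleton_ext_iff hlen hσ hX ha ht2 r hX ha (Or.inl rfl)
  simp only [hpow] at key
  refine ⟨fun i hi => ?_, fun i => ?_⟩
  · obtain ⟨q, rfl⟩ := Nat.exists_eq_succ_of_ne_zero hi.ne'
    rw [← exists_lt_modEq_iff, ← syzygyShift_odd (show len Λ X ≤ m by omega) q]
    exact key (2 * q + 1)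
  · rw [← exists_lt_add_modEq_iff hn ht, ← syzygyShift_even (show len Λ X ≤ m by omega) i]
    exact key (2 * i)

end Rigidity
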